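/- arXiv:math/0410085 — 7 statements merged into one kernel-verified Lean document; each statement's English description precedes it below -/
import Mathlib

section
/- Let n be a positive integer and let k be an even nonnegative integer. Then (3^(k+1) + 1) * E_k ≡ 2 * 3^k * ∑_{j=0}^{2^n - 1} (-1)^(j-1) * (2j+1)^k * ⌊(3j+1)/2^n⌋ (mod 2^(n+2)). (This is the congruence ((3^(k+1)+1)/4) E_k ≡ (3^k/2) ∑_{j=0}^{2^n-1} (-1)^(j-1) (2j+1)^k ⌊(3j+1)/2^n⌋ (mod 2^n) with both sides multiplied by 4; note that (3^(k+1)+1)/4 is an odd integer when k is even.) -/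
/-- The Euler numbers: `E 0 = 1` and
`E n = -∑_{0 ≤ k < n, n - k even} (n choose k) * E k` for `n ≥ 1`. -/
def eulerNumber : ℕ → ℤ
  | 0 => 1
  | n + 1 =>
    -∑ k ∈ (Finset.range (n + 1)).attach,
      if Even (n + 1 - k.1) then ((n + 1).choose k.1 : ℤ) * eulerNumber k.1 else 0
  decreasing_by exact Finset.mem_range.mp k.2

/-- The Euler polynomial `E_n(x) = ∑_{k=0}^n (n choose k) (E_k / 2^k) (x - 1/2)^(n-k)`. -/
noncomputable def eulerPoly (n : ℕ) : Polynomial ℚ :=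
  ∑ k ∈ Finset.range (n + 1),
    Polynomial.C ((n.choose k : ℚ) * (eulerNumber k : ℚ) / 2 ^ k) *
      (Polynomial.X - Polynomial.C (1 / 2)) ^ (n - k)

open Finset in
/-- The defining recursion of the Euler numbers as a sum over all indices. -/
theorem sum_choose_mul_eulerNumber (m : ℕ) (hm : m ≠ 0) :
    ∑ i ∈ range (m + 1), (if Even (m - i) then (m.choose i : ℤ) * eulerNumber i else 0) = 0 := by
  obtain ⟨n, rfl⟩ := Nat.exists_eq_succ_of_ne_zero hm
  rw [sum_range_succ]
  have h : eulerNumber (n + 1) = -∑ i ∈ (range (n + 1)).attach,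
      if Even (n + 1 - i.1) then ((n + 1).choose i.1 : ℤ) * eulerNumber i.1 else 0 := by
    rw [eulerNumber]
  rw [sum_attach (range (n + 1)) (fun i => if Even (n + 1 - i) then
    ((n + 1).choose i : ℤ) * eulerNumber i else 0)] at h
  simp [h]

theorem eulerNumber_of_odd (m : ℕ) (hm : Odd m) : eulerNumber m = 0 := by
  induction m using Nat.strong_induction_on with
  | _ m ih =>
    have h := sum_choose_mul_eulerNumber m hm.pos.ne'
    rw [Finset.sum_range_succ, Finset.sum_eq_zero] at h
    · simpa using h
    · intro i hi
      have hi := Finset.mem_range.mp hi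
      split_ifs with he
      · have : Odd i := by
          rw [Nat.even_sub hi.le] at he
          rw [← Nat.not_even_iff_odd] at hm ⊢
          tauto
        simp [ih i hi this]
      · rfl

/-- The linear functional on `ℤ[X]` sending `X ^ i` to the `i`-th Euler number. -/
noncomputable def eulerFunctional : Polynomial ℤ →ₗ[ℤ] ℤ :=
  Polynomial.lsum fun i => LinearMap.mulRight ℤ (eulerNumber i)

theorem eulerFunctional_C_mul_X_pow (a : ℤ) (i : ℕ) :
    eulerFunctional (Polynomial.C a * Polynomial.X ^ i) = a * eulerNumber i := by
  rw [Polynomial.C_mul_X_pow_eq_monomial]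
  simp [eulerFunctional, Polynomial.sum_monomial_index]

theorem eulerFunctional_X_add_C_pow (y : ℤ) (m : ℕ) :
    eulerFunctional ((Polynomial.X + Polynomial.C y) ^ m) =
      ∑ i ∈ Finset.range (m + 1), y ^ (m - i) * m.choose i * eulerNumber i := by
  rw [add_pow, map_sum]
  refine Finset.sum_congr rfl fun i _ => ?_
  rw [← eulerFunctional_C_mul_X_pow]
  congr 1
  simp only [map_mul, map_pow, map_natCast]
  ring

theorem eulerFunctional_shift_pow (m : ℕ) :
    eulerFunctional ((Polynomial.X + Polynomial.C 1) ^ m) +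
      eulerFunctional ((Polynomial.X + Polynomial.C (-1)) ^ m) = 2 * 0 ^ m := by
  rcases eq_or_ne m 0 with rfl | hm
  · have := eulerFunctional_C_mul_X_pow 1 0
    simp [eulerNumber] at this
    simp [this]
  · rw [eulerFunctional_X_add_C_pow, eulerFunctional_X_add_C_pow, ← Finset.sum_add_distrib]
    have h := congrArg (2 * ·) (sum_choose_mul_eulerNumber m hm)
    simp only [Finset.mul_sum] at h
    rw [zero_pow hm, ← h]
    refine Finset.sum_congr rfl fun i _ => ?_
    split_ifs with he
    · rw [he.neg_one_pow]; ring
    · rw [(Nat.not_even_iff_odd.mp he).neg_one_pow]; ring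

theorem eulerFunctional_comp_add (P : Polynomial ℤ) :
    eulerFunctional (P.comp (Polynomial.X + Polynomial.C 1)) +
      eulerFunctional (P.comp (Polynomial.X + Polynomial.C (-1))) = 2 * P.eval 0 := by
  induction P using Polynomial.induction_on' with
  | add p q hp hq =>
    simp only [Polynomial.add_comp, map_add, Polynomial.eval_add] at *
    linarith
  | monomial m a =>
    have h := eulerFunctional_shift_pow m
    simp only [Polynomial.monomial_comp, ← Polynomial.smul_eq_C_mul, map_smul,
      Polynomial.eval_monomial, smul_eq_mul]
    linear_combination a * h

theorem eulerFunctional_X_add_C_recurrence (c : ℤ) (m : ℕ) :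
    eulerFunctional ((Polynomial.X + Polynomial.C (c + 1)) ^ m) +
      eulerFunctional ((Polynomial.X + Polynomial.C (c - 1)) ^ m) = 2 * c ^ m := by
  have h := eulerFunctional_comp_add ((Polynomial.X + Polynomial.C c) ^ m)
  simp only [Polynomial.pow_comp, Polynomial.add_comp, Polynomial.X_comp, Polynomial.C_comp,
    Polynomial.eval_pow, Polynomial.eval_add, Polynomial.eval_X, Polynomial.eval_C,
    zero_add] at h
  rw [← h]
  congr 3 <;> simp only [map_add, map_sub, map_neg] <;> ring

/-- Alternating sums of powers of odd numbers in terms of Euler numbers. -/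
theorem two_mul_alternating_sum_odd_pow (m N : ℕ) :
    2 * ∑ j ∈ Finset.range N, (-1 : ℤ) ^ j * (2 * (j : ℤ) + 1) ^ m =
      eulerFunctional (Polynomial.X ^ m) -
        (-1) ^ N * eulerFunctional ((Polynomial.X + Polynomial.C (2 * (N : ℤ))) ^ m) := by
  induction N with
  | zero => simp
  | succ N ih =>
    have h := eulerFunctional_X_add_C_recurrence (2 * (N : ℤ) + 1) m
    rw [show (2 * (N : ℤ) + 1 + 1) = 2 * ((N + 1 : ℕ) : ℤ) by push_cast; ring,
      show (2 * (N : ℤ) + 1 - 1) = 2 * (N : ℤ) by ring] at h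
    rw [Finset.sum_range_succ, mul_add, ih, pow_succ]
    linear_combination -(-1 : ℤ) ^ N * h

theorem eulerFunctional_X_add_C_pow_odd (k : ℕ) (hk : Even k) (y : ℤ) :
    y ^ 3 ∣ eulerFunctional ((Polynomial.X + Polynomial.C y) ^ (k + 1)) -
      y * (k + 1) * eulerNumber k := by
  rw [eulerFunctional_X_add_C_pow, Finset.sum_range_succ, Finset.sum_range_succ,
    eulerNumber_of_odd _ hk.add_one]
  have h : y ^ 3 ∣ ∑ i ∈ Finset.range k,
      y ^ (k + 1 - i) * ((k + 1).choose i : ℤ) * eulerNumber i := by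
    refine Finset.dvd_sum fun i hi => ?_
    have hi := Finset.mem_range.mp hi
    rcases Nat.even_or_odd i with he | ho
    · obtain ⟨a, rfl⟩ := he
      obtain ⟨b, rfl⟩ := hk
      exact dvd_mul_of_dvd_left (dvd_mul_of_dvd_left (pow_dvd_pow y (by omega)) _) _
    · simp [eulerNumber_of_odd i ho]
  convert h using 1
  simp

theorem alternating_sum_odd_pow_modEq (k N : ℕ) (hk : Even k) (hN : Even N) :
    ∑ j ∈ Finset.range N, (-1 : ℤ) ^ j * (2 * (j : ℤ) + 1) ^ (k + 1) ≡
      -(N * (k + 1) * eulerNumber k) [ZMOD 4 * (N : ℤ) ^ 2] := by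
  have h := two_mul_alternating_sum_odd_pow (k + 1) N
  have h0 := eulerFunctional_C_mul_X_pow 1 (k + 1)
  rw [map_one, one_mul, one_mul, eulerNumber_of_odd _ hk.add_one] at h0
  rw [h0, hN.neg_one_pow] at h
  obtain ⟨c, hc⟩ := eulerFunctional_X_add_C_pow_odd k hk (2 * (N : ℤ))
  refine (Int.modEq_iff_dvd.mpr ⟨N * c, ?_⟩)
  have h2 : (2 : ℤ) ≠ 0 := two_ne_zero
  apply mul_left_cancel₀ h2
  linear_combination hc - h

theorem sum_range_mul_add_mod {M : Type*} [AddCommMonoid M] (f : ℕ → M) (a b N : ℕ)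
    (ha : N.Coprime a) :
    ∑ j ∈ Finset.range N, f ((a * j + b) % N) = ∑ j ∈ Finset.range N, f j := by
  have hmaps : ∀ j ∈ Finset.range N, (a * j + b) % N ∈ Finset.range N := fun j hj =>
    Finset.mem_range.mpr (Nat.mod_lt _ (by have := Finset.mem_range.mp hj; omega))
  have hinj : Set.InjOn (fun j => (a * j + b) % N) (Finset.range N : Set ℕ) := by
    intro i hi j hj hij
    have hi := Finset.mem_range.mp hi
    have hj := Finset.mem_range.mp hj
    have h : a * i ≡ a * j [MOD N] := Nat.ModEq.add_right_cancel' b hij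
    exact (Nat.ModEq.cancel_left_of_coprime ha h).eq_of_lt_of_lt hi hj
  exact Finset.sum_nbij (fun j => (a * j + b) % N) hmaps hinj
    (Finset.surjOn_of_injOn_of_card_le _ hmaps hinj le_rfl) fun _ _ => rfl

/-- First-order binomial expansion modulo the square of the increment. -/
theorem sub_pow_succ_modEq (x y : ℤ) (k : ℕ) :
    (x - y) ^ (k + 1) ≡ x ^ (k + 1) - (k + 1) * y * x ^ k [ZMOD y ^ 2] := by
  induction k with
  | zero => simp
  | succ k ih =>
    rw [pow_succ (x - y)]
    refine (ih.mul_right _).trans (Int.modEq_iff_dvd.mpr ⟨-((k + 1) * x ^ k), ?_⟩)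
    push_cast
    ring

theorem three_pow_mul_alternating_sum_modEq (k N : ℕ) (hN : Even N) (h3 : N.Coprime 3) :
    (3 ^ (k + 1) + 1) * ∑ j ∈ Finset.range N, (-1 : ℤ) ^ j * (2 * (j : ℤ) + 1) ^ (k + 1) ≡
      N * (k + 1) * (2 * 3 ^ k * ∑ j ∈ Finset.range N,
        (-1 : ℤ) ^ j * (2 * (j : ℤ) + 1) ^ k * (((3 * j + 1) / N : ℕ) : ℤ))
      [ZMOD 4 * (N : ℤ) ^ 2] := by
  rw [add_mul, one_mul]
  nth_rewrite 2 [← sum_range_mul_add_mod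
    (fun j => (-1 : ℤ) ^ j * (2 * (j : ℤ) + 1) ^ (k + 1)) 3 1 N h3]
  simp only [Finset.mul_sum]
  rw [← Finset.sum_add_distrib]
  refine Int.ModEq.sum fun j _ => ?_
  have hdiv := Nat.div_add_mod (3 * j + 1) N
  set q := (3 * j + 1) / N
  set r := (3 * j + 1) % N
  have hsign : (-1 : ℤ) ^ r = -(-1) ^ j := by
    have h := congrArg (fun t => (-1 : ℤ) ^ t) hdiv
    simp only [pow_add, pow_mul, hN.neg_one_pow, one_pow, one_mul, pow_one] at h
    rw [h]
    norm_num
  have hr : 2 * (r : ℤ) + 1 = 3 * (2 * j + 1) - 2 * N * q := by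
    have : (N : ℤ) * q + r = 3 * j + 1 := by exact_mod_cast hdiv
    linear_combination 2 * this
  obtain ⟨c, hc⟩ := (sub_pow_succ_modEq (3 * (2 * (j : ℤ) + 1)) (2 * N * q) k).dvd
  rw [hsign, hr]
  refine Int.modEq_iff_dvd.mpr ⟨-(-1) ^ j * q ^ 2 * c, ?_⟩
  rw [mul_pow, mul_pow] at hc
  linear_combination -(-1 : ℤ) ^ j * hc

theorem stmt_0 (n : ℕ) (hn : 0 < n) (k : ℕ) (hk : Even k) :
    (3 ^ (k + 1) + 1) * eulerNumber k ≡
      2 * 3 ^ k * ∑ j ∈ Finset.range (2 ^ n),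
        (-1 : ℤ) ^ (j + 1) * (2 * (j : ℤ) + 1) ^ k * ⌊(3 * (j : ℚ) + 1) / 2 ^ n⌋
      [ZMOD 2 ^ (n + 2)] := by
  have hN : Even (2 ^ n) := (even_two).pow_of_ne_zero hn.ne'
  have hfloor : ∀ j : ℕ, ⌊(3 * (j : ℚ) + 1) / 2 ^ n⌋ = (((3 * j + 1) / 2 ^ n : ℕ) : ℤ) := by
    intro j
    have := Rat.floor_natCast_div_natCast (3 * j + 1) (2 ^ n)
    push_cast at this ⊢
    exact this
  simp only [hfloor]
  have h1 := (alternating_sum_odd_pow_modEq k (2 ^ n) hk hN).mul_left (3 ^ (k + 1) + 1)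
  have h2 := three_pow_mul_alternating_sum_modEq k (2 ^ n) hN
    (Nat.Coprime.pow_left n (by norm_num))
  obtain ⟨c, hc⟩ := (h1.symm.trans h2).dvd
  simp only [pow_succ (-1 : ℤ), mul_neg_one, neg_mul, Finset.sum_neg_distrib]
  set S := ∑ j ∈ Finset.range (2 ^ n),
    (-1 : ℤ) ^ j * (2 * (j : ℤ) + 1) ^ k * (((3 * j + 1) / 2 ^ n : ℕ) : ℤ)
  have hcop : IsCoprime ((2 : ℤ) ^ (n + 2)) ((k : ℤ) + 1) := by
    obtain ⟨a, rfl⟩ := hk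
    exact IsCoprime.pow_left ⟨-(a : ℤ), 1, by push_cast; ring⟩
  refine Int.modEq_iff_dvd.mpr (hcop.dvd_of_dvd_mul_left ⟨-c, ?_⟩)
  have hne : (2 : ℤ) ^ n ≠ 0 := by positivity
  apply mul_left_cancel₀ hne
  push_cast at hc
  linear_combination -hc
end

section
/- Let n be a positive integer, let k be an even nonnegative integer, and let m be a positive odd integer. Then (m^(k+1) - (-1)^((m-1)/2)) * E_k ≡ 2 * m^k * ∑_{j=0}^{2^n - 1} (-1)^(j-1) * (2j+1)^k * ⌊(j*m + (m-1)/2)/2^n⌋ (mod 2^(n+2)). (This is the congruence ((m^(k+1) - (-1)^((m-1)/2))/4) E_k ≡ (m^k/2) ∑_{j=0}^{2^n-1} (-1)^(j-1) (2j+1)^k ⌊(jm+(m-1)/2)/2^n⌋ (mod 2^n) with both sides multiplied by 4.) -/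
theorem eulerNumber_succ (n : ℕ) :
    eulerNumber (n + 1) = -∑ k ∈ Finset.range (n + 1),
      if Even (n + 1 - k) then ((n + 1).choose k : ℤ) * eulerNumber k else 0 := by
  rw [eulerNumber, ← Finset.sum_attach (Finset.range (n + 1))]

theorem eulerNumber_eq_zero_of_odd {n : ℕ} (hn : Odd n) : eulerNumber n = 0 := by
  induction n using Nat.strong_induction_on with
  | _ n ih =>
    obtain ⟨t, rfl⟩ := hn
    rw [eulerNumber_succ, neg_eq_zero]
    refine Finset.sum_eq_zero fun k hk => ?_
    have hk' := Finset.mem_range.mp hk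
    split_ifs with h
    · have hodd : Odd k := by
        rw [Nat.odd_iff]
        rw [Nat.even_iff] at h
        omega
      rw [ih k hk' hodd, mul_zero]
    · rfl

/-- The polynomial function `x ↦ ∑ (k choose i) E_i x ^ (k - i)`, that is
`2 ^ k` times the Euler polynomial at `(x + 1) / 2`. -/
def eulerSum (k : ℕ) (x : ℤ) : ℤ :=
  ∑ i ∈ Finset.range (k + 1), (k.choose i : ℤ) * eulerNumber i * x ^ (k - i)

theorem eulerSum_zero_right (k : ℕ) : eulerSum k 0 = eulerNumber k := by
  rw [eulerSum, Finset.sum_range_succ, Finset.sum_eq_zero]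
  · simp
  · intro i hi
    have := Finset.mem_range.mp hi
    rw [zero_pow (by omega), mul_zero]

theorem eulerSum_add (k : ℕ) (x y : ℤ) :
    eulerSum k (x + y) =
      ∑ l ∈ Finset.range (k + 1), (k.choose l : ℤ) * eulerSum l y * x ^ (k - l) := by
  have h₁ : ∀ i ∈ Finset.range (k + 1),
      (k.choose i : ℤ) * eulerNumber i * (x + y) ^ (k - i) =
        ∑ s ∈ Finset.range (k - i + 1), (k.choose i : ℤ) * eulerNumber i *
          (y ^ s * x ^ (k - i - s) * ((k - i).choose s : ℤ)) := by
    intro i _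
    rw [add_comm x y, add_pow, Finset.mul_sum]
  have h₂ : ∀ l ∈ Finset.range (k + 1),
      (k.choose l : ℤ) * eulerSum l y * x ^ (k - l) =
        ∑ i ∈ Finset.range (l + 1), (k.choose l : ℤ) *
          ((l.choose i : ℤ) * eulerNumber i * y ^ (l - i)) * x ^ (k - l) := by
    intro l _
    rw [eulerSum, Finset.mul_sum, Finset.sum_mul]
  rw [Finset.sum_congr rfl h₂, eulerSum, Finset.sum_congr rfl h₁, Finset.sum_sigma',
    Finset.sum_sigma']
  refine Finset.sum_bij' (fun p _ => ⟨p.1 + p.2, p.1⟩) (fun p _ => ⟨p.2, p.1 - p.2⟩) ?_ ?_ ?_ ?_ ?_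
  · rintro ⟨i, s⟩ h
    simp only [Finset.mem_sigma, Finset.mem_range] at h ⊢
    omega
  · rintro ⟨l, i⟩ h
    simp only [Finset.mem_sigma, Finset.mem_range] at h ⊢
    omega
  · rintro ⟨i, s⟩ h
    simp
  · rintro ⟨l, i⟩ h
    simp only [Finset.mem_sigma, Finset.mem_range] at h
    have : i + (l - i) = l := by omega
    simp [this]
  · rintro ⟨i, s⟩ h
    simp only [Finset.mem_sigma, Finset.mem_range] at h
    have hc : ((k.choose (i + s) : ℤ)) * ((i + s).choose i) = k.choose i * (k - i).choose s := by
      have := Nat.choose_mul (n := k) (k := i + s) (s := i) (by omega)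
      rw [Nat.add_sub_cancel_left] at this
      exact_mod_cast this
    simp only [Nat.add_sub_cancel_left, Nat.sub_sub]
    linear_combination (-(eulerNumber i * y ^ s * x ^ (k - (i + s)))) * hc

theorem eulerSum_one_add_eulerSum_neg_one (l : ℕ) (hl : l ≠ 0) :
    eulerSum l 1 + eulerSum l (-1) = 0 := by
  obtain ⟨t, rfl⟩ := Nat.exists_eq_succ_of_ne_zero hl
  have h : ∀ i ∈ Finset.range (t + 1),
      ((t + 1).choose i : ℤ) * eulerNumber i * 1 ^ (t + 1 - i) +
        ((t + 1).choose i : ℤ) * eulerNumber i * (-1) ^ (t + 1 - i) =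
      2 * if Even (t + 1 - i) then ((t + 1).choose i : ℤ) * eulerNumber i else 0 := by
    intro i _
    split_ifs with h
    · rw [h.neg_one_pow, one_pow]
      ring
    · rw [(Nat.not_even_iff_odd.mp h).neg_one_pow, one_pow]
      ring
  rw [eulerSum, eulerSum, ← Finset.sum_add_distrib, Finset.sum_range_succ,
    Finset.sum_congr rfl h, ← Finset.mul_sum]
  have := eulerNumber_succ t
  simp only [Nat.choose_self, Nat.sub_self, pow_zero, Nat.succ_eq_add_one]
  linear_combination 2 * this

theorem eulerSum_add_one_add_eulerSum_sub_one (k : ℕ) (x : ℤ) :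
    eulerSum k (x + 1) + eulerSum k (x - 1) = 2 * x ^ k := by
  rw [sub_eq_add_neg, eulerSum_add, eulerSum_add, ← Finset.sum_add_distrib,
    Finset.sum_eq_single 0]
  · simp [eulerSum, eulerNumber]
    ring
  · intro l _ hl
    linear_combination ((k.choose l : ℤ) * x ^ (k - l)) * eulerSum_one_add_eulerSum_neg_one l hl
  · simp

theorem two_mul_sum_neg_one_pow_mul_odd_pow (k N : ℕ) :
    2 * ∑ j ∈ Finset.range N, (-1 : ℤ) ^ j * (2 * (j : ℤ) + 1) ^ k =
      eulerNumber k - (-1) ^ N * eulerSum k (2 * N) := by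
  induction N with
  | zero => simp [eulerSum_zero_right]
  | succ N ih =>
    have h := eulerSum_add_one_add_eulerSum_sub_one k (2 * N + 1)
    rw [add_sub_cancel_right, show (2 * (N : ℤ) + 1 + 1) = 2 * (N + 1 : ℕ) by push_cast; ring] at h
    rw [Finset.sum_range_succ, mul_add, ih, pow_succ]
    linear_combination (-(-1 : ℤ) ^ N) * h

theorem pow_three_dvd_eulerSum_succ_sub (k : ℕ) (hk : Even k) (y : ℤ) :
    y ^ 3 ∣ eulerSum (k + 1) y - eulerNumber (k + 1) - (k + 1) * eulerNumber k * y := by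
  rw [eulerSum, Finset.sum_range_succ, Finset.sum_range_succ]
  simp only [Nat.choose_self, Nat.choose_succ_self_right, Nat.sub_self, Nat.add_sub_cancel_left]
  push_cast
  have h : y ^ 3 ∣ ∑ i ∈ Finset.range k,
      ((k + 1).choose i : ℤ) * eulerNumber i * y ^ (k + 1 - i) := by
    refine Finset.dvd_sum fun i hi => ?_
    have hi' := Finset.mem_range.mp hi
    rcases Nat.even_or_odd i with he | ho
    · refine Dvd.dvd.mul_left (pow_dvd_pow y ?_) _
      rw [Nat.even_iff] at hk he
      omega
    · rw [eulerNumber_eq_zero_of_odd ho]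
      simp
  convert h using 1
  ring

theorem floor_div_two_pow (n j c : ℕ) :
    ⌊((j : ℚ) * (2 * c + 1 : ℕ) + (((2 * c + 1 : ℕ) : ℚ) - 1) / 2) / 2 ^ n⌋ =
      (((j * (2 * c + 1) + c) / 2 ^ n : ℕ) : ℤ) := by
  have h : ((j : ℚ) * (2 * c + 1 : ℕ) + (((2 * c + 1 : ℕ) : ℚ) - 1) / 2) / 2 ^ n =
      ((j * (2 * c + 1) + c : ℕ) : ℚ) / ((2 ^ n : ℕ) : ℚ) := by
    push_cast
    ring
  rw [h, Rat.floor_natCast_div_natCast]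
  push_cast
  rfl

/-- Multiplication by an odd number permutes the odd residues modulo `2 ^ (n + 1)`. -/
theorem sum_range_affine_mod_two_pow {M : Type*} [AddCommMonoid M] (n c : ℕ) (f : ℕ → M) :
    ∑ j ∈ Finset.range (2 ^ n), f ((j * (2 * c + 1) + c) % 2 ^ n) =
      ∑ j ∈ Finset.range (2 ^ n), f j := by
  have hmaps : ∀ j ∈ Finset.range (2 ^ n),
      (j * (2 * c + 1) + c) % 2 ^ n ∈ Finset.range (2 ^ n) := fun j _ =>
    Finset.mem_range.mpr (Nat.mod_lt _ (by positivity))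
  have hinj : Set.InjOn (fun j => (j * (2 * c + 1) + c) % 2 ^ n) (Finset.range (2 ^ n)) := by
    intro a ha b hb hab
    have h₁ : a * (2 * c + 1) ≡ b * (2 * c + 1) [MOD 2 ^ n] := Nat.ModEq.add_right_cancel' c hab
    have hcop : Nat.gcd (2 ^ n) (2 * c + 1) = 1 := by
      apply Nat.Coprime.pow_left
      simp
    have h₂ := Nat.ModEq.cancel_right_of_coprime hcop h₁
    exact h₂.eq_of_lt_of_lt (by simpa using ha) (by simpa using hb)
  exact Finset.sum_nbij _ hmaps hinj
    (Finset.surjOn_of_injOn_of_card_le _ hmaps hinj le_rfl) fun _ _ => rfl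

theorem add_mul_pow_succ_modEq (r y q : ℤ) (k : ℕ) :
    (r + y * q) ^ (k + 1) ≡ r ^ (k + 1) + (k + 1) * y * q * (r + y * q) ^ k [ZMOD y ^ 2] := by
  obtain ⟨z, hz⟩ := Polynomial.powAddExpansion r (y * q) (k + 1)
  obtain ⟨w, hw⟩ : y ∣ (r + y * q) ^ k - r ^ k :=
    (Dvd.intro q (by ring : y * q = r + y * q - r)).trans (sub_dvd_pow_sub_pow _ _ k)
  rw [Nat.add_sub_cancel] at hz
  push_cast at hz
  refine (Int.modEq_iff_dvd.mpr ⟨(k + 1) * q * w - z * q ^ 2, ?_⟩)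
  linear_combination ((k : ℤ) + 1) * y * q * hw - hz

/-- The Voronoi-type congruence for alternating sums of powers of odd numbers. -/
theorem voronoi_alternating_sum_modEq (n : ℕ) (hn : 0 < n) (k c : ℕ) :
    (((2 * c + 1 : ℕ) : ℤ) ^ (k + 1) - (-1) ^ c) *
        ∑ j ∈ Finset.range (2 ^ n), (-1 : ℤ) ^ j * (2 * (j : ℤ) + 1) ^ (k + 1) ≡
      (k + 1) * 2 ^ (n + 1) * (((2 * c + 1 : ℕ) : ℤ) ^ k *
        ∑ j ∈ Finset.range (2 ^ n), (-1 : ℤ) ^ j * (2 * (j : ℤ) + 1) ^ k *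
          (((j * (2 * c + 1) + c) / 2 ^ n : ℕ) : ℤ)) [ZMOD (2 ^ (n + 1)) ^ 2] := by
  have hperm := sum_range_affine_mod_two_pow n c
    (fun i => (-1 : ℤ) ^ i * (2 * (i : ℤ) + 1) ^ (k + 1))
  rw [sub_mul]
  nth_rewrite 2 [← hperm]
  rw [Finset.mul_sum, Finset.mul_sum, Finset.mul_sum, Finset.mul_sum, ← Finset.sum_sub_distrib]
  refine Int.ModEq.sum fun j _ => ?_
  have hdm := Nat.mod_add_div (j * (2 * c + 1) + c) (2 ^ n)
  set i := (j * (2 * c + 1) + c) % 2 ^ n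
  set q := (j * (2 * c + 1) + c) / 2 ^ n
  have hsign : (-1 : ℤ) ^ c * (-1) ^ i = (-1) ^ j := by
    have he : Even (2 ^ n * q) := ((even_two.pow_of_ne_zero hn.ne').mul_right q)
    have h₁ : (-1 : ℤ) ^ i = (-1) ^ (j * (2 * c + 1) + c) := by
      rw [← hdm, pow_add, he.neg_one_pow, mul_one]
    rw [h₁, ← pow_add, show c + (j * (2 * c + 1) + c) = 2 * (j * c + c) + j by ring, pow_add,
      pow_mul]
    simp
  have hdiv : (2 * (j : ℤ) + 1) * (2 * c + 1 : ℕ) = (2 * (i : ℤ) + 1) + 2 ^ (n + 1) * (q : ℤ) := by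
    have h : (i : ℤ) + 2 ^ n * q = j * (2 * c + 1) + c := by exact_mod_cast hdm
    push_cast
    linear_combination (-2 : ℤ) * h
  have key := (add_mul_pow_succ_modEq (2 * (i : ℤ) + 1) (2 ^ (n + 1)) q k).mul_left ((-1 : ℤ) ^ j)
  rw [← hdiv, mul_pow, mul_pow] at key
  have := key.sub_right ((-1 : ℤ) ^ j * (2 * (i : ℤ) + 1) ^ (k + 1))
  rw [← mul_assoc ((-1 : ℤ) ^ c), hsign]
  convert this using 1 <;> ring

theorem stmt_1 (n : ℕ) (hn : 0 < n) (k : ℕ) (hk : Even k)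
    (m : ℕ) (hm : 0 < m) (hmo : Odd m) :
    ((m : ℤ) ^ (k + 1) - (-1) ^ ((m - 1) / 2)) * eulerNumber k ≡
      2 * (m : ℤ) ^ k * ∑ j ∈ Finset.range (2 ^ n),
        (-1 : ℤ) ^ (j + 1) * (2 * (j : ℤ) + 1) ^ k *
          ⌊((j : ℚ) * m + ((m : ℚ) - 1) / 2) / 2 ^ n⌋
      [ZMOD 2 ^ (n + 2)] := by
  obtain ⟨c, rfl⟩ := hmo
  rw [show (2 * c + 1 - 1) / 2 = c by omega]
  simp only [floor_div_two_pow, pow_succ (-1 : ℤ), mul_neg_one, neg_mul, Finset.sum_neg_distrib]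
  have hV := voronoi_alternating_sum_modEq n hn k c
  have hT := two_mul_sum_neg_one_pow_mul_odd_pow (k + 1) (2 ^ n)
  rw [(even_two.pow_of_ne_zero hn.ne').neg_one_pow, one_mul,
    show (2 * ((2 ^ n : ℕ) : ℤ)) = 2 ^ (n + 1) by push_cast; ring] at hT
  obtain ⟨u, hu⟩ := pow_three_dvd_eulerSum_succ_sub k hk (2 ^ (n + 1))
  obtain ⟨v, hv⟩ := Int.modEq_iff_dvd.mp hV
  set T := ∑ j ∈ Finset.range (2 ^ n), (-1 : ℤ) ^ j * (2 * (j : ℤ) + 1) ^ (k + 1)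
  set S := ∑ j ∈ Finset.range (2 ^ n), (-1 : ℤ) ^ j * (2 * (j : ℤ) + 1) ^ k *
          (((j * (2 * c + 1) + c) / 2 ^ n : ℕ) : ℤ)
  set A := ((2 * c + 1 : ℕ) : ℤ) ^ (k + 1) - (-1) ^ c
  set B := ((2 * c + 1 : ℕ) : ℤ) ^ k
  have hcop : IsCoprime ((2 : ℤ) ^ (n + 2)) (k + 1) := by
    refine IsCoprime.pow_left ?_
    obtain ⟨t, rfl⟩ := hk
    exact ⟨-t, 1, by push_cast; ring⟩
  refine Int.modEq_iff_dvd.mpr (hcop.dvd_of_dvd_mul_left ?_)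
  have hy : (2 : ℤ) ^ (n + 1) ≠ 0 := by positivity
  refine ⟨-v + A * u * 2 ^ n, mul_left_cancel₀ hy ?_⟩
  rw [pow_succ _ (n + 1)]
  have h2 : (2 : ℤ) ^ (n + 1) = 2 ^ n * 2 := pow_succ _ _
  rw [h2] at *
  linear_combination (-2) * hv - A * hT + A * hu
end

section
/- Let k be a nonnegative integer and let q be a positive odd integer. Then E_k ≡ ∑_{j=0}^{q-1} (-1)^j * (2j+1)^k (mod q). -/
theorem add_one_pow_add_sub_one_pow {R : Type*} [CommRing R] (x : R) (n : ℕ) :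
    (x + 1) ^ n + (x - 1) ^ n =
      2 * ∑ k ∈ Finset.range (n + 1), if Even (n - k) then (n.choose k : R) * x ^ k else 0 := by
  rw [sub_eq_add_neg, add_pow, add_pow, ← Finset.sum_add_distrib, Finset.mul_sum]
  refine Finset.sum_congr rfl fun k _ ↦ ?_
  split_ifs with h
  · rw [h.neg_one_pow, one_pow]
    ring
  · rw [(Nat.not_even_iff_odd.mp h).neg_one_pow, one_pow]
    ring

theorem sum_neg_one_pow_mul_add_one {R : Type*} [CommRing R] (f : ℕ → R) (q : ℕ) :
    ∑ j ∈ Finset.range q, (-1) ^ j * (f (j + 1) + f j) = f 0 - (-1) ^ q * f q := by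
  induction q with
  | zero => simp
  | succ q ih =>
    rw [Finset.sum_range_succ, ih]
    ring

/-- The alternating sums of powers of odd numbers satisfy, up to a boundary term, the recurrence
of the Euler numbers. -/
theorem two_mul_sum_choose_mul_alternating_sum {q : ℕ} (hqo : Odd q) (n : ℕ) :
    2 * ∑ k ∈ Finset.range (n + 1), (if Even (n - k) then (n.choose k : ℤ) *
      ∑ j ∈ Finset.range q, (-1 : ℤ) ^ j * (2 * (j : ℤ) + 1) ^ k else 0) =
      0 ^ n + (2 * (q : ℤ)) ^ n := by
  have telescope := sum_neg_one_pow_mul_add_one (fun j : ℕ ↦ (2 * (j : ℤ)) ^ n) q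
  simp only [hqo.neg_one_pow, Nat.cast_zero, mul_zero, neg_one_mul, sub_neg_eq_add] at telescope
  rw [← telescope]
  have key (j : ℕ) : (2 * ((j + 1 : ℕ) : ℤ)) ^ n + (2 * (j : ℤ)) ^ n =
      2 * ∑ k ∈ Finset.range (n + 1),
        if Even (n - k) then (n.choose k : ℤ) * (2 * (j : ℤ) + 1) ^ k else 0 := by
    rw [← add_one_pow_add_sub_one_pow]
    push_cast
    ring
  simp only [key, Finset.mul_sum]
  rw [Finset.sum_comm]
  refine Finset.sum_congr rfl fun k _ ↦ ?_
  split_ifs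
  · simp only [Finset.mul_sum]
    exact Finset.sum_congr rfl fun j _ ↦ by ring
  · simp

theorem stmt_4 (k q : ℕ) (hq : 0 < q) (hqo : Odd q) :
    eulerNumber k ≡ ∑ j ∈ Finset.range q, (-1 : ℤ) ^ j * (2 * (j : ℤ) + 1) ^ k
      [ZMOD q] := by
  induction k using Nat.strong_induction_on with
  | _ k ih =>
  have recurrence := two_mul_sum_choose_mul_alternating_sum hqo k
  cases k with
  | zero =>
    simp only [zero_add, Finset.sum_range_one, Nat.sub_zero, Even.zero, if_true,
      Nat.choose_self, Nat.cast_one, one_mul, pow_zero] at recurrence ⊢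
    rw [eulerNumber, show ∑ j ∈ Finset.range q, (-1 : ℤ) ^ j * 1 = 1 by linarith]
  | succ n =>
    have dvd_two_mul : (q : ℤ) ∣ 2 * ∑ k ∈ Finset.range (n + 1 + 1),
        (if Even (n + 1 - k) then ((n + 1).choose k : ℤ) *
          ∑ j ∈ Finset.range q, (-1 : ℤ) ^ j * (2 * (j : ℤ) + 1) ^ k else 0) := by
      rw [recurrence, zero_pow n.succ_ne_zero, zero_add]
      exact (Dvd.intro_left 2 rfl).trans (dvd_pow_self _ n.succ_ne_zero)
    have coprime : IsCoprime (q : ℤ) 2 := by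
      exact_mod_cast Nat.isCoprime_iff_coprime.mpr hqo.coprime_two_right
    have dvd_sum := coprime.dvd_of_dvd_mul_left dvd_two_mul
    rw [Finset.sum_range_succ, Nat.sub_self, if_pos Even.zero, Nat.choose_self, Nat.cast_one,
      one_mul] at dvd_sum
    have lower_terms : ∑ k ∈ Finset.range (n + 1),
        (if Even (n + 1 - k) then ((n + 1).choose k : ℤ) * eulerNumber k else 0) ≡
        ∑ k ∈ Finset.range (n + 1), (if Even (n + 1 - k) then ((n + 1).choose k : ℤ) *
          ∑ j ∈ Finset.range q, (-1 : ℤ) ^ j * (2 * (j : ℤ) + 1) ^ k else 0) [ZMOD q] := by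
      refine Int.ModEq.sum fun k hk ↦ ?_
      split_ifs
      · exact (ih k (Finset.mem_range.mp hk)).mul_left _
      · rfl
    rw [eulerNumber_succ]
    refine lower_terms.neg.trans (Int.modEq_iff_dvd.mpr ?_)
    rwa [sub_neg_eq_add, add_comm]
end

section
/- Let a be an integer, let k and m be positive integers, and let q > 1 be an integer with gcd(m, q) = 1. Then the polynomial (1/k) * (m^k * B_k((x+a)/m) - B_k(x)) - ∑_{j=0}^{q-1} (⌊(a+jm)/q⌋ + (1-m)/2) * (x+a+jm)^(k-1), as an element of ℚ[x], equals q times a polynomial in ℚ[x] each of whose coefficients is a rational q-adic integer, i.e. can be written a/b with integers a, b, b > 0, gcd(b, q) = 1. (Here (1-m)/2 is a rational q-adic integer since q or m is odd.) -/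
open Polynomial Finset

/-- The subring of `ℚ` of rational `q`-adic integers. -/
def ratIntegers (q : ℕ) : Subring ℚ where
  carrier := {r | Nat.Coprime r.den q}
  mul_mem' {r s} hr hs := Nat.Coprime.of_dvd_left (Rat.mul_den_dvd r s) (Nat.Coprime.mul_left hr hs)
  one_mem' := by simp
  add_mem' {r s} hr hs := Nat.Coprime.of_dvd_left (Rat.add_den_dvd r s) (Nat.Coprime.mul_left hr hs)
  zero_mem' := by simp
  neg_mem' {r} hr := by simpa using hr

/-- The subring of `ℚ[X]` of polynomials whose coefficients are rational `q`-adic integers. -/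
noncomputable def polyIntegers (q : ℕ) : Subring ℚ[X] := liftsRing (ratIntegers q).subtype

theorem mem_polyIntegers {q : ℕ} {p : ℚ[X]} :
    p ∈ polyIntegers q ↔ ∀ i, Nat.Coprime (p.coeff i).den q := by
  rw [polyIntegers, ← lifts_iff_liftsRing, lifts_iff_coeff_lifts]
  refine forall_congr' fun i => ?_
  simp only [Subring.coe_subtype, Subtype.range_coe_subtype]
  rfl

theorem C_mem_polyIntegers {q : ℕ} {r : ℚ} (h : Nat.Coprime r.den q) :
    C r ∈ polyIntegers q := by
  rw [mem_polyIntegers]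
  intro i
  rw [coeff_C]
  split_ifs
  · exact h
  · simp

theorem X_mem_polyIntegers (q : ℕ) : (X : ℚ[X]) ∈ polyIntegers q := by
  rw [mem_polyIntegers]
  intro i
  rw [coeff_X]
  split_ifs <;> simp

theorem coprime_den_inv {m q : ℕ} (h : Nat.Coprime m q) : Nat.Coprime ((1 : ℚ) / m).den q := by
  rcases Nat.eq_zero_or_pos m with rfl | hm
  · simp
  · rw [one_div, Rat.inv_natCast_den_of_pos hm]
    exact h

theorem coprime_den_one_sub_half {m q : ℕ} (h : Nat.Coprime m q) :
    Nat.Coprime ((1 - (m : ℚ)) / 2).den q := by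
  rcases Nat.even_or_odd m with hm | ⟨t, rfl⟩
  · have h2 : Nat.Coprime 2 q := Nat.Coprime.of_dvd_left hm.two_dvd h
    have := (ratIntegers q).mul_mem ((ratIntegers q).sub_mem (ratIntegers q).one_mem
      (natCast_mem (ratIntegers q) m)) (coprime_den_inv h2)
    rw [div_eq_mul_one_div]
    exact this
  · have : (1 - ((2 * t + 1 : ℕ) : ℚ)) / 2 = ((-t : ℤ) : ℚ) := by push_cast; ring
    rw [this]
    simp

/-- Second order Taylor expansion with `q`-integral remainder. -/
theorem exists_comp_add_eq {q : ℕ} {p u c : ℚ[X]} (hp : p ∈ polyIntegers q)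
    (hu : u ∈ polyIntegers q) (hc : c ∈ polyIntegers q) :
    ∃ g ∈ polyIntegers q, p.comp (u + c) = p.comp u + p.derivative.comp u * c + c ^ 2 * g := by
  have key (n : ℕ) : ∃ g ∈ polyIntegers q,
      (u + c) ^ n = u ^ n + n * u ^ (n - 1) * c + c ^ 2 * g := by
    obtain ⟨g, hg⟩ := powAddExpansion (⟨u, hu⟩ : polyIntegers q) ⟨c, hc⟩ n
    refine ⟨g, g.2, ?_⟩
    have := congrArg Subtype.val hg
    push_cast at this
    rw [this]
    ring
  choose g hg hgs using key
  refine ⟨∑ i ∈ range (p.natDegree + 1), C (p.coeff i) * g i,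
    sum_mem fun i _ => mul_mem (C_mem_polyIntegers (mem_polyIntegers.1 hp i)) (hg i), ?_⟩
  have hd : p.derivative.comp u =
      ∑ i ∈ range (p.natDegree + 1), C (p.coeff i) * (i * u ^ (i - 1)) := by
    conv_lhs => rw [p.as_sum_range_C_mul_X_pow]
    simp [derivative_X_pow, Polynomial.sum_comp]
  rw [hd, comp_eq_sum_left, comp_eq_sum_left, sum_over_range _ (by simp),
    sum_over_range _ (by simp), sum_mul, mul_sum, ← sum_add_distrib, ← sum_add_distrib]
  refine sum_congr rfl fun i _ => ?_
  rw [hgs]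
  ring

theorem comp_mem_polyIntegers {q : ℕ} {p u : ℚ[X]} (hp : p ∈ polyIntegers q)
    (hu : u ∈ polyIntegers q) : p.comp u ∈ polyIntegers q := by
  rw [comp_eq_sum_left, sum_over_range _ (by simp)]
  exact sum_mem fun i _ =>
    mul_mem (C_mem_polyIntegers (mem_polyIntegers.1 hp i)) (pow_mem hu i)

theorem derivative_mem_polyIntegers {q : ℕ} {p : ℚ[X]} (hp : p ∈ polyIntegers q) :
    derivative p ∈ polyIntegers q := by
  rw [mem_polyIntegers] at hp ⊢
  intro i
  rw [coeff_derivative]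
  exact (ratIntegers q).mul_mem (hp (i + 1))
    ((ratIntegers q).add_mem (natCast_mem _ i) (ratIntegers q).one_mem)

theorem exists_natCast_mul_mem_polyIntegers (q : ℕ) (p : ℚ[X]) :
    ∃ d : ℕ, 0 < d ∧ (d : ℚ[X]) * p ∈ polyIntegers q := by
  induction p using Polynomial.induction_on' with
  | add p r hp hr =>
    obtain ⟨d, hd, hdp⟩ := hp
    obtain ⟨e, he, her⟩ := hr
    refine ⟨d * e, Nat.mul_pos hd he, ?_⟩
    have : ((d * e : ℕ) : ℚ[X]) * (p + r) = e * (d * p) + d * (e * r) := by push_cast; ring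
    rw [this]
    exact add_mem (mul_mem (natCast_mem _ _) hdp) (mul_mem (natCast_mem _ _) her)
  | monomial n r =>
    refine ⟨r.den, r.den_pos, ?_⟩
    have : (r.den : ℚ[X]) * monomial n r = (r.num : ℚ[X]) * X ^ n := by
      rw [← C_mul_X_pow_eq_monomial, ← mul_assoc, ← C_eq_natCast, ← C_mul, mul_comm,
        mul_comm _ r, Rat.mul_den_eq_num, ← C_eq_intCast, mul_comm]
    rw [this]
    exact mul_mem (intCast_mem _ _) (pow_mem (X_mem_polyIntegers q) n)

theorem natCast_mul_sum_add_pow (n N : ℕ) (u : ℚ[X]) :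
    ((n + 1 : ℕ) : ℚ[X]) * ∑ j ∈ range N, (u + j) ^ n =
      (Polynomial.bernoulli (n + 1)).comp (u + N) - (Polynomial.bernoulli (n + 1)).comp u := by
  induction N with
  | zero => simp
  | succ N ih =>
    have h := congrArg (fun p : ℚ[X] => p.comp (u + N)) (bernoulli_comp_one_add_X (n + 1))
    simp only [comp_assoc, add_comp, one_comp, X_comp, nsmul_eq_mul, mul_comp, natCast_comp,
      X_pow_comp, Nat.add_sub_cancel] at h
    have e : u + ((N + 1 : ℕ) : ℚ[X]) = 1 + (u + N) := by push_cast; ring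
    rw [sum_range_succ, mul_add, ih, e, h]
    ring

theorem sum_range_emod {A : Type*} [AddCommMonoid A] {m N : ℕ} (hN : 0 < N)
    (h : Nat.Coprime m N) (a : ℤ) (F : ℤ → A) :
    ∑ j ∈ range N, F ((a + j * m) % N) = ∑ r ∈ range N, F r := by
  have hN' : (0 : ℤ) < N := by exact_mod_cast hN
  have hnn (j : ℕ) : 0 ≤ (a + j * m) % (N : ℤ) := Int.emod_nonneg _ hN'.ne'
  have hmaps : ∀ j ∈ range N, ((a + j * m) % (N : ℤ)).toNat ∈ range N := fun j _ => by
    have := Int.emod_lt_of_pos (a + j * m) hN'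
    have := hnn j
    simp only [mem_range]
    omega
  have hinj : Set.InjOn (fun j : ℕ => ((a + j * m) % (N : ℤ)).toNat) (range N) := by
    intro i hi j hj hij
    simp only [coe_range, Set.mem_Iio] at hi hj
    have e : (a + i * m) % (N : ℤ) = (a + j * m) % (N : ℤ) := by
      have := hnn i
      have := hnn j
      simp only at hij
      omega
    have e2 : (i * m : ℤ) ≡ j * m [ZMOD N] := Int.ModEq.add_left_cancel' a e
    have e3 : i * m ≡ j * m [MOD N] := by
      rw [← Int.natCast_modEq_iff]; exact_mod_cast e2
    have e4 := Nat.ModEq.cancel_right_of_coprime (by rwa [Nat.gcd_comm]) e3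
    exact Nat.ModEq.eq_of_lt_of_lt e4 hi hj
  refine sum_nbij (fun j => ((a + j * m) % (N : ℤ)).toNat) hmaps hinj
    (surjOn_of_injOn_of_card_le _ hmaps hinj le_rfl) fun j _ => ?_
  rw [Int.toNat_of_nonneg (hnn j)]

/-- The distribution relation of the regularised first Bernoulli distribution. -/
theorem sum_range_ediv_add_half {m M : ℕ} (hM : 0 < M) (h : Nat.Coprime m M) (a : ℤ) :
    ∑ t ∈ range M, ((((a + t * m) / (M : ℤ) : ℤ) : ℚ) + (1 - (m : ℚ)) / 2) =
      a + (1 - (m : ℚ)) / 2 := by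
  have hp := sum_range_emod hM h a (fun r => (r : ℚ))
  have hdm (t : ℕ) : (((a + t * m) % (M : ℤ) : ℤ) : ℚ) =
      a + t * m - M * (((a + t * m) / (M : ℤ) : ℤ) : ℚ) := by
    rw [Int.emod_def]; push_cast; ring
  have hg : (∑ t ∈ range M, (t : ℚ)) * 2 = M * (M - 1) := by
    have := congrArg (Nat.cast : ℕ → ℚ) (Finset.sum_range_id_mul_two M)
    push_cast [Nat.cast_sub (Nat.succ_le_of_lt hM)] at this
    exact this
  simp only [hdm, sum_sub_distrib, sum_add_distrib, sum_const, card_range, nsmul_eq_mul,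
    ← mul_sum, ← sum_mul, Int.cast_natCast] at hp
  have hM0 : (M : ℚ) ≠ 0 := by positivity
  apply mul_left_cancel₀ hM0
  rw [sum_add_distrib, sum_const, card_range, nsmul_eq_mul]
  linear_combination -hp + ((m : ℚ) - 1) / 2 * hg

theorem sum_range_mul_eq {A : Type*} [AddCommMonoid A] (q M : ℕ) (f : ℕ → A) :
    ∑ i ∈ range (q * M), f i = ∑ j ∈ range q, ∑ t ∈ range M, f (j + q * t) := by
  rw [Finset.sum_comm]
  induction M with
  | zero => simp
  | succ M ih =>
    rw [Nat.mul_succ, sum_range_add, ih, sum_range_succ]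
    simp [add_comm]

/-- The sum approximating `(m^(n+1) B_{n+1}((X+a)/m) - B_{n+1}(X)) / (n+1)` modulo `N`. -/
noncomputable def floorSum (a : ℤ) (n m N : ℕ) : ℚ[X] :=
  ∑ j ∈ range N, C ((((a + j * m) / (N : ℤ) : ℤ) : ℚ) + (1 - (m : ℚ)) / 2) *
    (X + (a : ℚ[X]) + (j : ℚ[X]) * (m : ℚ[X])) ^ n

theorem shift_mem_polyIntegers (q : ℕ) (a : ℤ) (m j : ℕ) :
    X + (a : ℚ[X]) + (j : ℚ[X]) * (m : ℚ[X]) ∈ polyIntegers q :=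
  add_mem (add_mem (X_mem_polyIntegers q) (intCast_mem _ a))
    (mul_mem (natCast_mem _ j) (natCast_mem _ m))

theorem exists_floorSum_mul_eq {q m M : ℕ} (hq : 0 < q) (hmq : Nat.Coprime m q)
    (hM : 0 < M) (h : Nat.Coprime m M) (a : ℤ) (n : ℕ) :
    ∃ g ∈ polyIntegers q, floorSum a n m (q * M) = floorSum a n m q + q * g := by
  have key (j t : ℕ) : ∃ g ∈ polyIntegers q,
      (X + (a : ℚ[X]) + ((j + q * t : ℕ) : ℚ[X]) * (m : ℚ[X])) ^ n =
        (X + (a : ℚ[X]) + (j : ℚ[X]) * (m : ℚ[X])) ^ n + (q : ℚ[X]) * g := by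
    obtain ⟨g, hg⟩ := sub_dvd_pow_sub_pow
      (⟨_, shift_mem_polyIntegers q a m (j + q * t)⟩ : polyIntegers q)
      ⟨_, shift_mem_polyIntegers q a m j⟩ n
    refine ⟨t * m * g, mul_mem (mul_mem (natCast_mem _ t) (natCast_mem _ m)) g.2, ?_⟩
    have := congrArg Subtype.val hg
    push_cast at this
    push_cast
    linear_combination this
  choose g hg hgs using key
  have hfl (j t : ℕ) : (a + ((j + q * t : ℕ) : ℤ) * m) / ((q * M : ℕ) : ℤ) =
      ((a + j * m) / (q : ℤ) + t * m) / (M : ℤ) := by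
    have hq' : (q : ℤ) ≠ 0 := by exact_mod_cast hq.ne'
    rw [Nat.cast_mul, ← Int.ediv_ediv_of_nonneg (by positivity)]
    congr 1
    rw [← Int.add_mul_ediv_left _ _ hq']
    congr 1
    push_cast
    ring
  let w (j t : ℕ) : ℚ := ((((a + j * m) / (q : ℤ) + t * m) / (M : ℤ) : ℤ) : ℚ) + (1 - (m : ℚ)) / 2
  have hw (j t : ℕ) : C (w j t) ∈ polyIntegers q := by
    apply C_mem_polyIntegers
    exact (ratIntegers q).add_mem (intCast_mem (ratIntegers q) _) (coprime_den_one_sub_half hmq)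
  refine ⟨∑ j ∈ range q, ∑ t ∈ range M, C (w j t) * g j t,
    sum_mem fun j _ => sum_mem fun t _ => mul_mem (hw j t) (hg j t), ?_⟩
  rw [floorSum, floorSum, sum_range_mul_eq, mul_sum, ← sum_add_distrib]
  refine sum_congr rfl fun j _ => ?_
  rw [← sum_range_ediv_add_half hM h, map_sum, sum_mul, mul_sum, ← sum_add_distrib]
  refine sum_congr rfl fun t _ => ?_
  rw [hfl, hgs]
  ring

theorem exists_natCast_mul_sub_floorSum_eq {q m : ℕ} (hm : 0 < m) (hmq : Nat.Coprime m q)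
    (a : ℤ) (n : ℕ) :
    ∃ d : ℕ, 0 < d ∧ ∀ N : ℕ, 0 < N → Nat.Coprime m N → ∃ g ∈ polyIntegers q,
      (d : ℚ[X]) * (C (1 / ((n + 1 : ℕ) : ℚ)) * ((m : ℚ[X]) ^ (n + 1) *
        (Polynomial.bernoulli (n + 1)).comp (C (1 / (m : ℚ)) * (X + (a : ℚ[X]))) -
          Polynomial.bernoulli (n + 1)) - floorSum a n m N) = N * g := by
  obtain ⟨d₁, hd₁, h₁⟩ := exists_natCast_mul_mem_polyIntegers q (Polynomial.bernoulli (n + 1))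
  obtain ⟨d₂, hd₂, h₂⟩ := exists_natCast_mul_mem_polyIntegers q (Polynomial.bernoulli (n + 2))
  set U : ℚ[X] := C (1 / (m : ℚ)) * (X + (a : ℚ[X])) with hU
  have hUS : U ∈ polyIntegers q := mul_mem (C_mem_polyIntegers (coprime_den_inv hmq))
    (add_mem (X_mem_polyIntegers q) (intCast_mem _ a))
  have hmU : (m : ℚ[X]) * U = X + (a : ℚ[X]) := by
    rw [hU, ← mul_assoc, ← C_eq_natCast, ← C_mul, mul_one_div_cancel (by positivity), C_1, one_mul]
  have hK : ((n + 1 : ℕ) : ℚ[X]) * C (1 / ((n + 1 : ℕ) : ℚ)) = 1 := by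
    rw [← C_eq_natCast, ← C_mul, mul_one_div_cancel (by positivity), C_1]
  set c : ℚ[X] := C ((1 - (m : ℚ)) / 2)
  have hcS : c ∈ polyIntegers q := C_mem_polyIntegers (coprime_den_one_sub_half hmq)
  refine ⟨d₁ * d₂ * (n + 2) * (n + 1), by positivity, fun N hN hmN => ?_⟩
  have hNS : (N : ℚ[X]) ∈ polyIntegers q := natCast_mem _ N
  have hz (j : ℕ) : (m : ℚ[X]) * (U + (j : ℚ[X])) = X + (a : ℚ[X]) + (j : ℚ[X]) * (m : ℚ[X]) := by
    linear_combination hmU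
  obtain ⟨g₁, hg₁, e₁⟩ := exists_comp_add_eq h₂ hUS hNS
  obtain ⟨g₂, hg₂, e₂⟩ := exists_comp_add_eq h₂ (X_mem_polyIntegers q) hNS
  obtain ⟨g₃, hg₃, e₃⟩ : ∃ g ∈ polyIntegers q,
      ((d₁ : ℚ[X]) * Polynomial.bernoulli (n + 1)).comp (U + N) =
        ((d₁ : ℚ[X]) * Polynomial.bernoulli (n + 1)).comp U + N * g := by
    obtain ⟨g, hg, e⟩ := exists_comp_add_eq h₁ hUS hNS
    refine ⟨_, add_mem (comp_mem_polyIntegers (derivative_mem_polyIntegers h₁) hUS)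
      (mul_mem hNS hg), ?_⟩
    rw [e]
    ring
  have s₁ := natCast_mul_sum_add_pow (n + 1) N U
  have s₂ := natCast_mul_sum_add_pow (n + 1) N X
  have s₃ := natCast_mul_sum_add_pow n N U
  have hder : derivative (Polynomial.bernoulli (n + 2)) =
      ((n : ℚ[X]) + 2) * Polynomial.bernoulli (n + 1) := by
    have := derivative_bernoulli_add_one (n + 1)
    push_cast at this
    rw [this]; ring
  simp only [derivative_mul, derivative_natCast, zero_mul, zero_add, hder, mul_comp, natCast_comp,
    add_comp, ofNat_comp, Nat.cast_ofNat, comp_X] at e₁ e₂ e₃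
  let f (j : ℕ) : ℤ := (a + j * m) / (N : ℤ)
  have key (j : ℕ) : ∃ g ∈ polyIntegers q,
      (X + (((a + j * m) % (N : ℤ) : ℤ) : ℚ[X])) ^ (n + 1) =
        (X + (a : ℚ[X]) + (j : ℚ[X]) * (m : ℚ[X])) ^ (n + 1) -
          ((n : ℚ[X]) + 1) * (X + (a : ℚ[X]) + (j : ℚ[X]) * (m : ℚ[X])) ^ n *
            ((N : ℚ[X]) * (f j : ℚ[X])) + (N : ℚ[X]) ^ 2 * g := by
    obtain ⟨g, hg⟩ := powAddExpansion
      (⟨_, shift_mem_polyIntegers q a m j⟩ : polyIntegers q)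
      (-(N * (f j : polyIntegers q))) (n + 1)
    refine ⟨g * (f j) ^ 2, mul_mem g.2 (pow_mem (intCast_mem _ _) 2), ?_⟩
    have := congrArg Subtype.val hg
    push_cast at this
    rw [Int.emod_def]
    push_cast
    have e : X + ((a : ℚ[X]) + (j : ℚ[X]) * (m : ℚ[X]) -
        (N : ℚ[X]) * (((a + j * m) / (N : ℤ) : ℤ) : ℚ[X])) =
      X + (a : ℚ[X]) + (j : ℚ[X]) * (m : ℚ[X]) + -((N : ℚ[X]) * (f j : ℚ[X])) := by
      simp only [f]
      ring
    rw [e, this]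
    ring
  choose h hh hhs using key
  have hperm := sum_range_emod hN hmN a (fun r => (X + (r : ℚ[X])) ^ (n + 1))
  simp only [hhs, sum_add_distrib, sum_sub_distrib, ← mul_sum, Int.cast_natCast] at hperm
  have t₁ : (m : ℚ[X]) ^ (n + 1) * ∑ j ∈ range N, (U + (j : ℚ[X])) ^ (n + 1) =
      ∑ j ∈ range N, (X + (a : ℚ[X]) + (j : ℚ[X]) * (m : ℚ[X])) ^ (n + 1) := by
    simp only [mul_sum, ← mul_pow, hz]
  have t₃ : (m : ℚ[X]) ^ n * ∑ j ∈ range N, (U + (j : ℚ[X])) ^ n =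
      ∑ j ∈ range N, (X + (a : ℚ[X]) + (j : ℚ[X]) * (m : ℚ[X])) ^ n := by
    simp only [mul_sum, ← mul_pow, hz]
  have hfs : floorSum a n m N =
      ∑ j ∈ range N, (f j : ℚ[X]) * (X + (a : ℚ[X]) + (j : ℚ[X]) * (m : ℚ[X])) ^ n +
        c * ∑ j ∈ range N, (X + (a : ℚ[X]) + (j : ℚ[X]) * (m : ℚ[X])) ^ n := by
    rw [floorSum, mul_sum, ← sum_add_distrib]
    refine sum_congr rfl fun j _ => ?_
    rw [C_add, C_eq_intCast, add_mul]
  have t₂ : ∑ j ∈ range N, ((n : ℚ[X]) + 1) * (X + (a : ℚ[X]) + (j : ℚ[X]) * (m : ℚ[X])) ^ n *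
      ((N : ℚ[X]) * (f j : ℚ[X])) = ((n : ℚ[X]) + 1) * (N : ℚ[X]) *
        ∑ j ∈ range N, (f j : ℚ[X]) * (X + (a : ℚ[X]) + (j : ℚ[X]) * (m : ℚ[X])) ^ n := by
    rw [mul_sum]
    exact sum_congr rfl fun j _ => by ring
  rw [t₂, ← t₁] at hperm
  rw [hfs, ← t₃]
  have hN0 : (N : ℚ[X]) ≠ 0 := by exact_mod_cast hN.ne'
  refine ⟨(d₁ : ℚ[X]) * (g₂ - (m : ℚ[X]) ^ (n + 1) * g₁ -
      (d₂ : ℚ[X]) * ((n : ℚ[X]) + 2) * ∑ j ∈ range N, h j) -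
    c * (d₂ : ℚ[X]) * ((n : ℚ[X]) + 2) * (m : ℚ[X]) ^ n * g₃, ?_, ?_⟩
  · have hn : (n : ℚ[X]) ∈ polyIntegers q := natCast_mem _ n
    have h2 : (n : ℚ[X]) + 2 ∈ polyIntegers q := add_mem hn (ofNat_mem _ 2)
    have hmS : (m : ℚ[X]) ∈ polyIntegers q := natCast_mem _ m
    have hd₁S : (d₁ : ℚ[X]) ∈ polyIntegers q := natCast_mem _ d₁
    have hd₂S : (d₂ : ℚ[X]) ∈ polyIntegers q := natCast_mem _ d₂
    exact sub_mem (mul_mem hd₁S (sub_mem (sub_mem hg₂ (mul_mem (pow_mem hmS _) hg₁))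
      (mul_mem (mul_mem hd₂S h2) (sum_mem fun j _ => hh j))))
      (mul_mem (mul_mem (mul_mem (mul_mem hcS hd₂S) h2) (pow_mem hmS _)) hg₃)
  · apply mul_left_cancel₀ hN0
    push_cast at hK s₁ s₂ s₃ ⊢
    simp only [add_assoc, one_add_one_eq_two] at s₁ s₂ s₃
    simp only [comp_X] at s₂
    linear_combination
      (N : ℚ[X]) * (d₁ : ℚ[X]) * (d₂ : ℚ[X]) * ((n : ℚ[X]) + 2) *
        ((m : ℚ[X]) ^ (n + 1) * (Polynomial.bernoulli (n + 1)).comp U -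
        Polynomial.bernoulli (n + 1)) * hK + (d₁ : ℚ[X]) * (d₂ : ℚ[X]) * ((n : ℚ[X]) + 2) * hperm -
      (m : ℚ[X]) ^ (n + 1) * (d₁ : ℚ[X]) * ((d₂ : ℚ[X]) * s₁ + e₁) +
      (d₁ : ℚ[X]) * ((d₂ : ℚ[X]) * s₂ + e₂) -
      (N : ℚ[X]) * (d₂ : ℚ[X]) * ((n : ℚ[X]) + 2) * c * (m : ℚ[X]) ^ n * ((d₁ : ℚ[X]) * s₃ + e₃)

theorem exists_coprime_factorization (q d : ℕ) (hd : 0 < d) :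
    ∃ s d₁ d₂ : ℕ, d = d₁ * d₂ ∧ d₁ ∣ q ^ s ∧ Nat.Coprime d₂ q := by
  induction d using Nat.strong_induction_on with
  | _ d ih =>
    by_cases h : Nat.Coprime d q
    · exact ⟨0, 1, d, by simp, by simp, h⟩
    · obtain ⟨e, he⟩ := Nat.gcd_dvd_left d q
      have hg : 1 < Nat.gcd d q := by
        have := Nat.gcd_pos_of_pos_left q hd
        have : Nat.gcd d q ≠ 1 := h
        omega
      have he0 : 0 < e := Nat.pos_of_ne_zero fun h0 => by simp [h0] at he; omega
      have hlt : e < d := by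
        calc e < Nat.gcd d q * e := by nlinarith
          _ = d := he.symm
      obtain ⟨s, d₁, d₂, h1, h2, h3⟩ := ih e hlt he0
      refine ⟨s + 1, Nat.gcd d q * d₁, d₂, ?_, ?_, h3⟩
      · rw [mul_assoc, ← h1]; exact he
      · rw [pow_succ, mul_comm]
        exact mul_dvd_mul h2 (Nat.gcd_dvd_right d q)

theorem stmt_5 (a : ℤ) (k m : ℕ) (hk : 0 < k) (hm : 0 < m)
    (q : ℕ) (hq : 1 < q) (hmq : Nat.Coprime m q) :
    ∃ g : Polynomial ℚ,
      Polynomial.C (1 / (k : ℚ)) *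
          (Polynomial.C ((m : ℚ) ^ k) *
              (Polynomial.bernoulli k).comp
                (Polynomial.C (1 / (m : ℚ)) * (Polynomial.X + Polynomial.C (a : ℚ))) -
            Polynomial.bernoulli k) -
        (∑ j ∈ Finset.range q,
          Polynomial.C ((⌊((a : ℚ) + j * m) / q⌋ : ℚ) + (1 - (m : ℚ)) / 2) *
            (Polynomial.X + Polynomial.C ((a : ℚ) + j * m)) ^ (k - 1)) =
      Polynomial.C (q : ℚ) * g ∧
      ∀ i : ℕ, ∃ b c : ℤ, 0 < c ∧ Int.gcd c q = 1 ∧ g.coeff i = (b : ℚ) / c := by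
  obtain ⟨n, rfl⟩ : ∃ n, k = n + 1 := ⟨k - 1, by omega⟩
  obtain ⟨d, hd, H⟩ := exists_natCast_mul_sub_floorSum_eq hm hmq a n
  obtain ⟨s, d₁, d₂, rfl, h1, h2⟩ := exists_coprime_factorization q d hd
  have hd₁ : 0 < d₁ := Nat.pos_of_mul_pos_right hd
  have hd₂ : 0 < d₂ := Nat.pos_of_mul_pos_left hd
  have hmd : Nat.Coprime m d₁ := Nat.Coprime.of_dvd_right h1 (Nat.Coprime.pow_right s hmq)
  obtain ⟨g₁, hg₁, e₁⟩ := H (q * d₁) (by positivity) (Nat.Coprime.mul_right hmq hmd)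
  obtain ⟨g₂, hg₂, e₂⟩ := exists_floorSum_mul_eq (by omega) hmq hd₁ hmd a n
  have hg : C (1 / (d₂ : ℚ)) * g₁ + g₂ ∈ polyIntegers q :=
    add_mem (mul_mem (C_mem_polyIntegers (coprime_den_inv h2)) hg₁) hg₂
  refine ⟨C (1 / (d₂ : ℚ)) * g₁ + g₂, ?_, fun i => ?_⟩
  · have hfl : ∑ j ∈ range q, C ((⌊((a : ℚ) + j * m) / q⌋ : ℚ) + (1 - (m : ℚ)) / 2) *
        (X + C ((a : ℚ) + j * m)) ^ (n + 1 - 1) = floorSum a n m q := by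
      rw [floorSum]
      refine sum_congr rfl fun j _ => ?_
      have := Rat.floor_intCast_div_natCast (a + j * m) q
      push_cast at this
      rw [this]
      simp [add_assoc]
    have hC : (d₂ : ℚ[X]) * C (1 / (d₂ : ℚ)) = 1 := by
      rw [← C_eq_natCast, ← C_mul, mul_one_div_cancel (by positivity), C_1]
    rw [hfl, C_pow, C_eq_natCast, C_eq_natCast, C_eq_intCast]
    rw [e₂] at e₁
    have hd0 : ((d₁ * d₂ : ℕ) : ℚ[X]) ≠ 0 := by exact_mod_cast hd.ne'
    apply mul_left_cancel₀ hd0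
    push_cast at e₁ ⊢
    linear_combination e₁ - (d₁ : ℚ[X]) * q * g₁ * hC
  · refine ⟨((C (1 / (d₂ : ℚ)) * g₁ + g₂).coeff i).num,
      ((C (1 / (d₂ : ℚ)) * g₁ + g₂).coeff i).den, ?_, ?_,
      (Rat.num_div_den _).symm⟩
    · exact_mod_cast Rat.den_pos _
    · exact_mod_cast mem_polyIntegers.1 hg i
end

section
/- Let a be an integer, let m and q be positive integers with q even and gcd(m, q) = 1 (so m is odd). Then ∑_{j=0}^{q-1} (-1)^(j-1) * (2*⌊(a+jm)/q⌋ + 1 - m) = m - (-1)^a. (Equivalently, ∑_{j=0}^{q-1} (-1)^(j-1) * (⌊(a+jm)/q⌋ + (1-m)/2) = (m - (-1)^a)/2.) -/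
theorem two_mul_sum_range_neg_one_pow_mul_self {q : ℕ} (hq : Even q) :
    2 * ∑ j ∈ Finset.range q, (-1 : ℤ) ^ (j + 1) * j = q := by
  obtain ⟨k, rfl⟩ := hq.exists_two_nsmul
  clear hq
  simp only [smul_eq_mul]
  induction k with
  | zero => simp
  | succ k ih =>
    rw [mul_add, mul_one, Finset.sum_range_succ, Finset.sum_range_succ, mul_add, mul_add, ih]
    simp only [pow_succ, pow_mul]
    push_cast
    ring

theorem sum_range_neg_one_pow_eq_zero {q : ℕ} (hq : Even q) :
    ∑ j ∈ Finset.range q, (-1 : ℤ) ^ (j + 1) = 0 := by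
  simp_rw [pow_succ, ← Finset.sum_mul, neg_one_geom_sum, if_pos hq, zero_mul]

theorem sum_range_affine_emod {M : Type*} [AddCommMonoid M] (a : ℤ) {m q : ℕ} (hq : 0 < q)
    (hmq : Nat.Coprime m q) (f : ℕ → M) :
    ∑ j ∈ Finset.range q, f ((a + j * m) % q).toNat = ∑ r ∈ Finset.range q, f r := by
  have hq0 : (0 : ℤ) < q := by exact_mod_cast hq
  have hmaps : Set.MapsTo (fun j : ℕ ↦ ((a + j * m) % q).toNat)
      (Finset.range q) (Finset.range q) := by
    intro j _
    have := Int.emod_lt_of_pos (a + j * m) hq0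
    simp only [Finset.coe_range, Set.mem_Iio]
    omega
  have hinj : Set.InjOn (fun j : ℕ ↦ ((a + j * m) % q).toNat) (Finset.range q) := by
    intro i hi j hj hij
    simp only [Finset.coe_range, Set.mem_Iio] at hi hj hij
    have hi0 := Int.emod_nonneg (a + i * m) hq0.ne'
    have hj0 := Int.emod_nonneg (a + j * m) hq0.ne'
    have hmod : a + i * m ≡ a + j * m [ZMOD q] := by
      unfold Int.ModEq
      omega
    have hmul : i * m ≡ j * m [MOD q] := by
      rw [← Int.natCast_modEq_iff]
      push_cast
      exact hmod.add_left_cancel'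
    exact (Nat.ModEq.cancel_right_of_coprime hmq.symm hmul).eq_of_lt_of_lt hi hj
  exact Finset.sum_nbij _ hmaps hinj (Finset.surjOn_of_injOn_of_card_le _ hmaps hinj le_rfl)
    fun _ _ ↦ rfl

theorem neg_one_pow_eq_of_affine_emod (a : ℤ) {m q : ℕ} (hq : 0 < q) (hq2 : Even q)
    (hm : Odd m) (j : ℕ) :
    (-1 : ℤ) ^ j = (-1) ^ a.natAbs * (-1) ^ ((a + j * m) % q).toNat := by
  rw [← pow_add]
  apply neg_one_pow_congr
  have hq0 : (q : ℤ) ≠ 0 := by exact_mod_cast hq.ne'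
  have hr := Int.toNat_of_nonneg (Int.emod_nonneg (a + j * m) hq0)
  have hdiv := Int.emod_add_mul_ediv (a + j * m) q
  rw [← hr] at hdiv
  have hpar := congrArg Even hdiv
  have hqe : Even (q : ℤ) := by exact_mod_cast hq2
  have hmo : ¬ Even (m : ℤ) := by exact_mod_cast Nat.not_even_iff_odd.mpr hm
  simp only [Int.even_add, Int.even_mul, hqe, hmo, Int.even_coe_nat, eq_iff_iff] at hpar
  rw [Nat.even_add, Int.natAbs_even]
  tauto

theorem stmt_7 (a : ℤ) (m q : ℕ) (hm : 0 < m) (hq : 0 < q) (hq2 : Even q)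
    (hmq : Nat.Coprime m q) :
    ∑ j ∈ Finset.range q,
        (-1 : ℤ) ^ (j + 1) * (2 * ⌊((a : ℚ) + j * m) / q⌋ + 1 - m) =
      m - (-1) ^ a.natAbs := by
  have hq0 : (q : ℤ) ≠ 0 := by exact_mod_cast hq.ne'
  have hm_odd : Odd m := by
    rw [← Nat.not_even_iff_odd]
    exact fun h ↦ Nat.not_coprime_of_dvd_of_dvd one_lt_two h.two_dvd hq2.two_dvd hmq
  have hfloor (j : ℕ) : ⌊((a : ℚ) + j * m) / q⌋ = (a + j * m) / q := by
    rw [← Rat.floor_intCast_div_natCast]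
    push_cast
    rfl
  have hterm (j : ℕ) : q * ((-1 : ℤ) ^ (j + 1) * (2 * ((a + j * m) / q) + 1 - m)) =
      (2 * a + q * (1 - m)) * (-1) ^ (j + 1) + m * (2 * ((-1) ^ (j + 1) * j)) -
        (-1) ^ a.natAbs * (2 * ((-1) ^ (((a + j * m) % q).toNat + 1) *
          (((a + j * m) % q).toNat : ℤ))) := by
    have hr := Int.toNat_of_nonneg (Int.emod_nonneg (a + j * m) hq0)
    have hdiv := Int.emod_add_mul_ediv (a + j * m) q
    have hsign := neg_one_pow_eq_of_affine_emod a hq hq2 hm_odd j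
    rw [hr]
    simp only [pow_succ]
    linear_combination -2 * (-1) ^ j * hdiv + 2 * ((a + j * m) % q) * hsign
  apply mul_left_cancel₀ hq0
  simp_rw [hfloor, Finset.mul_sum, hterm, Finset.sum_sub_distrib, Finset.sum_add_distrib,
    ← Finset.mul_sum]
  rw [sum_range_affine_emod a hq hmq (fun r ↦ (-1 : ℤ) ^ (r + 1) * r),
    two_mul_sum_range_neg_one_pow_mul_self hq2, sum_range_neg_one_pow_eq_zero hq2]
  ring
end

section
/- Let n be a positive integer and let k be an even nonnegative integer. Then ∑_{j=0}^{2^n - 1} (-1)^j * (2j+1)^k ≡ 0 (mod 2^(n+1)). -/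
theorem Int.add_two_pow_pow_modEq (a : ℤ) (n : ℕ) {k : ℕ} (hk : Even k) :
    (a + 2 ^ (n + 1)) ^ k ≡ a ^ k [ZMOD 2 ^ (n + 2)] := by
  obtain ⟨m, rfl⟩ := hk
  rw [← two_mul, pow_mul, pow_mul]
  refine Int.ModEq.pow m (Int.modEq_iff_dvd.mpr ⟨-(a + 2 ^ n), ?_⟩)
  ring

theorem stmt_8 (n : ℕ) (hn : 0 < n) (k : ℕ) (hk : Even k) :
    ∑ j ∈ Finset.range (2 ^ n), (-1 : ℤ) ^ j * (2 * (j : ℤ) + 1) ^ k ≡ 0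
      [ZMOD 2 ^ (n + 1)] := by
  induction n, hn using Nat.le_induction with
  | base =>
    have h := Int.add_two_pow_pow_modEq 1 0 hk
    norm_num at h
    simpa [Finset.sum_range_succ, sub_eq_add_neg] using (h.neg.add_left 1)
  | succ n hn ih =>
    have hn' : Even (2 ^ n) := (Nat.even_pow.mpr ⟨even_two, by omega⟩)
    have hshift : ∑ j ∈ Finset.range (2 ^ n),
          (-1 : ℤ) ^ (2 ^ n + j) * (2 * ((2 ^ n + j : ℕ) : ℤ) + 1) ^ k ≡
        ∑ j ∈ Finset.range (2 ^ n), (-1 : ℤ) ^ j * (2 * (j : ℤ) + 1) ^ k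
          [ZMOD 2 ^ (n + 2)] := by
      refine Int.ModEq.sum fun j _ => ?_
      rw [pow_add (-1), hn'.neg_one_pow, one_mul]
      convert (Int.add_two_pow_pow_modEq (2 * (j : ℤ) + 1) n hk).mul_left ((-1) ^ j) using 3
      push_cast
      ring
    rw [pow_succ 2 n, mul_two, Finset.sum_range_add]
    refine (hshift.add_left _).trans ?_
    rw [← two_mul, Int.modEq_zero_iff_dvd, pow_succ' 2 (n + 1)]
    exact mul_dvd_mul_left 2 (Int.modEq_zero_iff_dvd.mp ih)
end

section
/- Let k be a nonnegative integer and let q be a positive integer. Then 2^k * E_k(q + 1/2) is an integer and 2^k * E_k(q + 1/2) ≡ E_k (mod q), where E_k(q + 1/2) denotes the Euler polynomial E_k evaluated at the rational number q + 1/2. -/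
theorem stmt_11 (k q : ℕ) (hq : 0 < q) :
    ∃ c : ℤ, 2 ^ k * (eulerPoly k).eval ((q : ℚ) + 1 / 2) = (c : ℚ) ∧
      c ≡ eulerNumber k [ZMOD q] := by
  refine ⟨∑ i ∈ Finset.range (k + 1),
    (k.choose i : ℤ) * eulerNumber i * (2 * (q : ℤ)) ^ (k - i), ?_, ?_⟩
  · rw [eulerPoly, Polynomial.eval_finsetSum, Finset.mul_sum]
    push_cast
    refine Finset.sum_congr rfl fun i hi => ?_
    have hik : i ≤ k := Nat.lt_succ_iff.mp (Finset.mem_range.mp hi)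
    have hpow : (2 : ℚ) ^ k = 2 ^ i * 2 ^ (k - i) := by rw [← pow_add, Nat.add_sub_cancel' hik]
    simp only [Polynomial.eval_mul, Polynomial.eval_C, Polynomial.eval_pow, Polynomial.eval_sub,
      Polynomial.eval_X, add_sub_cancel_right]
    rw [hpow, mul_pow]
    field_simp
  · rw [Finset.sum_range_succ, Nat.choose_self, Nat.sub_self, pow_zero, Nat.cast_one, one_mul,
      mul_one]
    refine (Int.modEq_iff_dvd.mpr ?_).symm
    rw [add_sub_cancel_right]
    refine Finset.dvd_sum fun i hi => Dvd.dvd.mul_left (dvd_pow (dvd_mul_left _ _) ?_) _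
    exact Nat.sub_ne_zero_of_lt (Finset.mem_range.mp hi)
end
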